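/- Let m ≥ 1, n ≥ 1, 1 ≤ k ≤ n, n⃗ ∈ I_{k,n}; for each s ∈ {1,…,k} let q⃗_s = (q_{s,1},…,q_{s,j_s}) ∈ I_{j_s,n_s}, and let N⃗ ∈ I_{J,n} be the concatenated tuple (q_{1,1},…,q_{1,j_1},q_{2,1},…,q_{k,j_k}), where J = j_1+⋯+j_k. Then for every s ∈ {1,…,k}, every u ∈ {1,…,j_s}, and every ordered pair (i,i′) with 1 ≤ i < i′ ≤ mn: λ^{(m)}_{j_s,q⃗_s,u}(λ^{(m)}_{k,n⃗,s}(i,i′)) = λ^{(m)}_{J,N⃗,(j_1+⋯+j_{s−1}+u)}(i,i′). (This is the associativity of the left action of the associative operad on the divided powers γ_m𝓑 of the choose-two operad.) -/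

import Mathlib

noncomputable section

/-- Partial sum `n⃗^s = n₁ + ⋯ + n_{s−1}` (so `psum nv 1 = 0`). -/
def psum (nv : ℕ → ℕ) (s : ℕ) : ℕ := ∑ i ∈ Finset.Ico 1 s, nv i

/-- The block of `a` with respect to the tuple `nv`: the unique `s ≥ 1` with
`n⃗^s < a ≤ n⃗^{s+1}`, realized as the least `s ≥ 1` with `a ≤ n⃗^{s+1}`. -/
def blk (nv : ℕ → ℕ) (a : ℕ) : ℕ := sInf {s : ℕ | 1 ≤ s ∧ a ≤ psum nv (s + 1)}

/-- The column `a_i ∈ {1,…,n}` of `i ∈ {1,…,mn}`, i.e. the unique `a` with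
`i = (a−1)m + r`, `1 ≤ r ≤ m`. -/
def col (m i : ℕ) : ℕ := (i - 1) / m + 1

/-- The row `r_i ∈ {1,…,m}` of `i ∈ {1,…,mn}`. -/
def row (m i : ℕ) : ℕ := (i - 1) % m + 1

/-- `ι_r(i) = (i−1)m + r`. -/
def iot (m r i : ℕ) : ℕ := (i - 1) * m + r

/-- The right-action map `ρ^{(m)}_{k,n⃗}` on ordered pairs, with basepoint `+ = none`:
`ρ^{(m)}_{k,n⃗}(i,j) = ((s−1)m+r, (t−1)m+r)` if the block `s` of `a_i` is strictly smaller
than the block `t` of `a_j` and `r_i = r_j = r`; otherwise `+`. -/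
def rho (m : ℕ) (nv : ℕ → ℕ) (ij : ℕ × ℕ) : Option (ℕ × ℕ) :=
  if blk nv (col m ij.1) < blk nv (col m ij.2) ∧ row m ij.1 = row m ij.2 then
    some ((blk nv (col m ij.1) - 1) * m + row m ij.1,
          (blk nv (col m ij.2) - 1) * m + row m ij.1)
  else none

/-- The `s`-th component `λ^{(m)}_{k,n⃗,s}` of the left-action map, with basepoint `+ = none`:
`λ^{(m)}_{k,n⃗,s}(i,j) = ((a_i − n⃗^s − 1)m + r, (a_j − n⃗^s − 1)m + r)` if
`n⃗^s < a_i < a_j ≤ n⃗^{s+1}` and `r_i = r_j = r`; otherwise `+`. -/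
def lam (m : ℕ) (nv : ℕ → ℕ) (s : ℕ) (ij : ℕ × ℕ) : Option (ℕ × ℕ) :=
  if psum nv s < col m ij.1 ∧ col m ij.1 < col m ij.2 ∧ col m ij.2 ≤ psum nv (s + 1)
      ∧ row m ij.1 = row m ij.2 then
    some ((col m ij.1 - psum nv s - 1) * m + row m ij.1,
          (col m ij.2 - psum nv s - 1) * m + row m ij.1)
  else none

end

theorem psum_one (f : ℕ → ℕ) : psum f 1 = 0 := by simp [psum]

theorem psum_succ (f : ℕ → ℕ) {s : ℕ} (hs : 1 ≤ s) : psum f (s + 1) = psum f s + f s :=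
  Finset.sum_Ico_succ_top hs f

theorem psum_mono (f : ℕ → ℕ) : Monotone (psum f) := fun _ _ h =>
  Finset.sum_le_sum_of_subset (Finset.Ico_subset_Ico_right h)

theorem psum_succ_eq_sum_Icc (f : ℕ → ℕ) (s : ℕ) :
    psum f (s + 1) = ∑ i ∈ Finset.Icc 1 s, f i := rfl

/-- If `g` reads off the values `f 1, …, f l` after position `p`, then its partial sums are those
of `f`, shifted by the partial sum of `g` at `p + 1`. -/
theorem psum_shift {f g : ℕ → ℕ} {p l : ℕ} (h : ∀ u, 1 ≤ u → u ≤ l → g (p + u) = f u)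
    {u : ℕ} (hu : u ≤ l) : psum g (p + u + 1) = psum g (p + 1) + psum f (u + 1) := by
  induction u with
  | zero => simp [psum_one]
  | succ u ih =>
    rw [psum_succ g (by omega), psum_succ f (by omega), ← add_assoc p u 1,
      ih (by omega), add_assoc p u 1, h (u + 1) (by omega) hu, add_assoc]

/-- The partial sums of a concatenation at the start of each concatenated tuple. -/
theorem psum_concat {k : ℕ} {nv jj Nv : ℕ → ℕ} {q : ℕ → ℕ → ℕ}
    (hq : ∀ s, 1 ≤ s → s ≤ k → ∑ u ∈ Finset.Icc 1 (jj s), q s u = nv s)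
    (hNv : ∀ s, 1 ≤ s → s ≤ k → ∀ u, 1 ≤ u → u ≤ jj s → Nv (psum jj s + u) = q s u)
    {s : ℕ} (hs : 1 ≤ s) (hsk : s ≤ k) : psum Nv (psum jj s + 1) = psum nv s := by
  induction s, hs using Nat.le_induction with
  | base => simp [psum_one]
  | succ s hs ih =>
    rw [psum_succ jj hs, psum_succ nv hs, psum_shift (hNv s hs (by omega)) le_rfl,
      ih (by omega), psum_succ_eq_sum_Icc (q s), hq s hs (by omega)]

theorem col_mul_add_row {m : ℕ} (hm : 1 ≤ m) (c i : ℕ) : col m (c * m + row m i) = c + 1 := by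
  have h : (i - 1) % m < m := Nat.mod_lt _ hm
  simp only [col, row, ← add_assoc, Nat.add_sub_cancel]
  rw [mul_comm, Nat.mul_add_div hm, Nat.div_eq_of_lt h, add_zero]

theorem row_mul_add_row (m c i : ℕ) : row m (c * m + row m i) = row m i := by
  simp only [row, ← add_assoc, Nat.add_sub_cancel]
  rw [mul_comm, Nat.mul_add_mod, Nat.mod_mod]

/-- associativity of the left action of the associative operad on the
divided powers `γ_m𝓑` of the choose-two operad: for `n⃗ ∈ I_{k,n}`, `q⃗_s ∈ I_{j_s,n_s}`
and `N⃗` the concatenated tuple (of length `J = j₁ + ⋯ + j_k`),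
`λ^{(m)}_{j_s,q⃗_s,u} ∘ λ^{(m)}_{k,n⃗,s} = λ^{(m)}_{J,N⃗,(j₁+⋯+j_{s−1}+u)}`. -/
theorem stmt3 (m n k : ℕ) (hm : 1 ≤ m) (hn : 1 ≤ n)
    (hk1 : 1 ≤ k) (hkn : k ≤ n)
    (nv : ℕ → ℕ) (hnv : ∑ s ∈ Finset.Icc 1 k, nv s = n)
    (jj : ℕ → ℕ) (q : ℕ → ℕ → ℕ)
    (hjj : ∀ s, 1 ≤ s → s ≤ k → 1 ≤ jj s ∧ jj s ≤ nv s)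
    (hq : ∀ s, 1 ≤ s → s ≤ k → ∑ u ∈ Finset.Icc 1 (jj s), q s u = nv s)
    (J : ℕ) (hJ : J = ∑ s ∈ Finset.Icc 1 k, jj s)
    (Nv : ℕ → ℕ)
    (hNv : ∀ s, 1 ≤ s → s ≤ k → ∀ u, 1 ≤ u → u ≤ jj s →
      Nv (psum jj s + u) = q s u) :
    ∀ s, 1 ≤ s → s ≤ k → ∀ u, 1 ≤ u → u ≤ jj s →
      ∀ i i' : ℕ, 1 ≤ i → i < i' → i' ≤ m * n →
        Option.bind (lam m nv s (i, i')) (fun p => lam m (q s) u p)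
          = lam m Nv (psum jj s + u) (i, i') := by
  intro s hs hsk u hu hul i i' _ _ _
  obtain ⟨v, rfl⟩ : ∃ v, u = v + 1 := ⟨u - 1, by omega⟩
  have hstart : psum Nv (psum jj s + (v + 1)) = psum nv s + psum (q s) (v + 1) := by
    rw [← add_assoc, psum_shift (hNv s hs hsk) (by omega), psum_concat hq hNv hs hsk]
  have hend : psum Nv (psum jj s + (v + 1) + 1) = psum nv s + psum (q s) (v + 1 + 1) := by
    rw [psum_shift (hNv s hs hsk) hul, psum_concat hq hNv hs hsk]
  have hblock : psum (q s) (v + 1 + 1) ≤ nv s := by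
    rw [← hq s hs hsk, ← psum_succ_eq_sum_Icc]
    exact psum_mono _ (by omega)
  have hnext := psum_succ nv hs
  by_cases hc : psum nv s < col m i ∧ col m i < col m i' ∧ col m i' ≤ psum nv (s + 1)
      ∧ row m i = row m i'
  · obtain ⟨h1, h2, h3, h4⟩ := hc
    have e1 : col m i - psum nv s - 1 + 1 = col m i - psum nv s := by omega
    have e2 : col m i' - psum nv s - 1 + 1 = col m i' - psum nv s := by omega
    simp only [lam, h1, h2, h3, h4, and_self, if_true, Option.bind_some, col_mul_add_row hm,
      row_mul_add_row, e1, e2, hstart, hend]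
    simp only [Nat.sub_sub, add_assoc]
    congr 1
    simp only [and_true, true_and, eq_iff_iff]
    omega
  · have hd : ¬ (psum nv s + psum (q s) (v + 1) < col m i ∧ col m i < col m i' ∧
        col m i' ≤ psum nv s + psum (q s) (v + 1 + 1) ∧ row m i = row m i') := by
      rintro ⟨h1, h2, h3, h4⟩
      exact hc ⟨by omega, h2, by omega, h4⟩
    simp only [lam, hstart, hend, if_neg hc, if_neg hd, Option.bind_none]
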